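/- arXiv:2303.12013 — 2 statements merged into one kernel-verified Lean document; each statement's English description precedes it below -/
import Mathlib

section
/- Let H be a real inner product space, let N ≥ 1 be an integer, let Δt > 0, α > 0, C_P > 0, let e_0, e_1, …, e_N ∈ H, and let s_1, …, s_N ≥ 0 and ρ_1, …, ρ_N ≥ 0 be real numbers. Assume that ‖e_n‖ ≤ C_P · s_n for all 1 ≤ n ≤ N, and that for all 0 ≤ n ≤ N−1: (‖e_{n+1}‖² − ‖e_n‖²)/(2Δt) + (3α/4)·s_{n+1}² ≤ ρ_{n+1}·‖e_{n+1}‖. Then for every 1 ≤ m ≤ N: ‖e_m‖² + α·Δt·Σ_{n=1}^{m} s_n² ≤ ‖e_0‖² + (2 C_P²/α)·Δt·Σ_{n=1}^{m} ρ_n². -/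
/-- Young's inequality in the weighted form `r (c t) ≤ (α/4) t² + (c²/α) r²`. -/
theorem mul_mul_le_weighted_sq_add_sq {α : ℝ} (hα : 0 < α) (c r t : ℝ) :
    r * (c * t) ≤ α / 4 * t ^ 2 + c ^ 2 / α * r ^ 2 := by
  have h : α / 4 * t ^ 2 + c ^ 2 / α * r ^ 2 - r * (c * t) = (α * t / 2 - c * r) ^ 2 / α := by
    field_simp
    ring
  have : 0 ≤ (α * t / 2 - c * r) ^ 2 / α := by positivity
  linarith

/-- One time step of the energy estimate: the residual is absorbed by the dissipation. -/
theorem sq_add_dissipation_le_of_step {Δt α c a b t r : ℝ} (hΔt : 0 < Δt) (hα : 0 < α)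
    (hr : 0 ≤ r) (hb : b ≤ c * t)
    (h : (b ^ 2 - a ^ 2) / (2 * Δt) + 3 * α / 4 * t ^ 2 ≤ r * b) :
    b ^ 2 + α * Δt * t ^ 2 ≤ a ^ 2 + 2 * c ^ 2 / α * Δt * r ^ 2 := by
  have hrb : r * b ≤ r * (c * t) := mul_le_mul_of_nonneg_left hb hr
  have young := mul_mul_le_weighted_sq_add_sq hα c r t
  have hdiff : (b ^ 2 - a ^ 2) / (2 * Δt) ≤ c ^ 2 / α * r ^ 2 - α / 2 * t ^ 2 := by linarith
  rw [div_le_iff₀ (by positivity)] at hdiff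
  linear_combination hdiff

/-- Discrete energy estimate (telescoped form): if `‖eₙ‖ ≤ C_P sₙ` and
`(‖eₙ₊₁‖² − ‖eₙ‖²)/(2Δt) + (3α/4) sₙ₊₁² ≤ ρₙ₊₁ ‖eₙ₊₁‖`, then for every `1 ≤ m ≤ N`,
`‖e_m‖² + αΔt Σ_{n=1}^m sₙ² ≤ ‖e₀‖² + (2C_P²/α)Δt Σ_{n=1}^m ρₙ²`. -/
theorem discrete_energy_estimate
    {H : Type*} [NormedAddCommGroup H] [InnerProductSpace ℝ H]
    (N : ℕ) (hN : 1 ≤ N) (Δt α CP : ℝ) (hΔt : 0 < Δt) (hα : 0 < α) (hCP : 0 < CP)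
    (e : ℕ → H) (s ρ : ℕ → ℝ)
    (hs : ∀ n, 1 ≤ n → n ≤ N → 0 ≤ s n)
    (hρ : ∀ n, 1 ≤ n → n ≤ N → 0 ≤ ρ n)
    (hPoincare : ∀ n, 1 ≤ n → n ≤ N → ‖e n‖ ≤ CP * s n)
    (hstep : ∀ n, n ≤ N - 1 →
      (‖e (n + 1)‖ ^ 2 - ‖e n‖ ^ 2) / (2 * Δt) + (3 * α / 4) * s (n + 1) ^ 2
        ≤ ρ (n + 1) * ‖e (n + 1)‖) :
    ∀ m, 1 ≤ m → m ≤ N →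
      ‖e m‖ ^ 2 + α * Δt * ∑ n ∈ Finset.Icc 1 m, s n ^ 2
        ≤ ‖e 0‖ ^ 2 + (2 * CP ^ 2 / α) * Δt * ∑ n ∈ Finset.Icc 1 m, ρ n ^ 2 := by
  intro m hm
  induction m, hm using Nat.le_induction with
  | base =>
    intro h1
    simpa using sq_add_dissipation_le_of_step hΔt hα (hρ 1 le_rfl h1)
      (hPoincare 1 le_rfl h1) (hstep 0 (Nat.zero_le _))
  | succ m hm ih =>
    intro hmN
    have step := sq_add_dissipation_le_of_step hΔt hα (hρ (m + 1) (by omega) hmN)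
      (hPoincare (m + 1) (by omega) hmN) (hstep m (by omega))
    rw [Finset.sum_Icc_succ_top (by omega), Finset.sum_Icc_succ_top (by omega)]
    linear_combination step + ih (by omega)
end

section
/- Let H be a real inner product space, let N ≥ 1 be an integer, let Δt > 0, α > 0, C_P > 0, let e_0, e_1, …, e_N ∈ H, and let s_1, …, s_N ≥ 0 and ρ_1, …, ρ_N ≥ 0 be real numbers. Assume that ‖e_n‖ ≤ C_P · s_n for all 1 ≤ n ≤ N, and that for all 0 ≤ n ≤ N−1: (‖e_{n+1}‖² − ‖e_n‖²)/(2Δt) + (3α/4)·s_{n+1}² ≤ ρ_{n+1}·‖e_{n+1}‖. Then max_{1 ≤ n ≤ N} ‖e_n‖ + ( α·Δt·Σ_{n=1}^{N} s_n² )^{1/2} ≤ 2‖e_0‖ + 2 C_P √(2/α) · ( Δt·Σ_{n=1}^{N} ρ_n² )^{1/2}. -/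
theorem energy_step_of_young {Δt α C a b s r : ℝ} (hΔt : 0 < Δt) (hα : 0 < α)
    (hr : 0 ≤ r) (hb : b ≤ C * s)
    (h : (b ^ 2 - a ^ 2) / (2 * Δt) + (3 * α / 4) * s ^ 2 ≤ r * b) :
    b ^ 2 + α * Δt * s ^ 2 ≤ a ^ 2 + C ^ 2 * (2 / α) * (Δt * r ^ 2) := by
  have hrb : r * b ≤ r * (C * s) := mul_le_mul_of_nonneg_left hb hr
  have young : r * (C * s) ≤ C ^ 2 / α * r ^ 2 + α / 4 * s ^ 2 := by
    have key : C ^ 2 / α * r ^ 2 + α / 4 * s ^ 2 - r * (C * s)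
        = (C * r - α / 2 * s) ^ 2 / α := by
      field_simp
      ring
    have : 0 ≤ (C * r - α / 2 * s) ^ 2 / α := by positivity
    linarith
  have hdiv : (b ^ 2 - a ^ 2) / (2 * Δt) ≤ C ^ 2 / α * r ^ 2 - α / 2 * s ^ 2 := by linarith
  rw [div_le_iff₀ (by positivity)] at hdiv
  calc b ^ 2 + α * Δt * s ^ 2
      ≤ a ^ 2 + (C ^ 2 / α * r ^ 2 - α / 2 * s ^ 2) * (2 * Δt) + α * Δt * s ^ 2 := by linarith
    _ = a ^ 2 + C ^ 2 * (2 / α) * (Δt * r ^ 2) := by ring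

theorem add_sum_Icc_le_of_step {N : ℕ} {x y z : ℕ → ℝ}
    (h : ∀ n < N, x (n + 1) + y (n + 1) ≤ x n + z (n + 1)) :
    ∀ m ≤ N, x m + ∑ n ∈ Finset.Icc 1 m, y n ≤ x 0 + ∑ n ∈ Finset.Icc 1 m, z n := by
  intro m
  induction m with
  | zero => simp
  | succ m ih =>
    intro hm
    rw [Finset.sum_Icc_succ_top (by lia), Finset.sum_Icc_succ_top (by lia)]
    linarith [ih (by lia), h m (by lia)]


/-- Corollary of the discrete energy estimate: simultaneous `l^∞(L²)`-type and
`l²(H¹)`-type bounds: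
`max_{1≤n≤N} ‖eₙ‖ + (αΔt Σ sₙ²)^{1/2} ≤ 2‖e₀‖ + 2C_P√(2/α)(Δt Σ ρₙ²)^{1/2}`. -/
theorem discrete_energy_estimate_max
    {H : Type*} [NormedAddCommGroup H] [InnerProductSpace ℝ H]
    (N : ℕ) (hN : 1 ≤ N) (Δt α CP : ℝ) (hΔt : 0 < Δt) (hα : 0 < α) (hCP : 0 < CP)
    (e : ℕ → H) (s ρ : ℕ → ℝ)
    (hs : ∀ n, 1 ≤ n → n ≤ N → 0 ≤ s n)
    (hρ : ∀ n, 1 ≤ n → n ≤ N → 0 ≤ ρ n)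
    (hPoincare : ∀ n, 1 ≤ n → n ≤ N → ‖e n‖ ≤ CP * s n)
    (hstep : ∀ n, n ≤ N - 1 →
      (‖e (n + 1)‖ ^ 2 - ‖e n‖ ^ 2) / (2 * Δt) + (3 * α / 4) * s (n + 1) ^ 2
        ≤ ρ (n + 1) * ‖e (n + 1)‖) :
    (Finset.Icc 1 N).sup' (Finset.nonempty_Icc.mpr hN) (fun n => ‖e n‖)
        + Real.sqrt (α * Δt * ∑ n ∈ Finset.Icc 1 N, s n ^ 2)
      ≤ 2 * ‖e 0‖
        + 2 * CP * Real.sqrt (2 / α)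
            * Real.sqrt (Δt * ∑ n ∈ Finset.Icc 1 N, ρ n ^ 2) := by
  have energy : ∀ m ≤ N, ‖e m‖ ^ 2 + α * Δt * ∑ n ∈ Finset.Icc 1 m, s n ^ 2
      ≤ ‖e 0‖ ^ 2 + CP ^ 2 * (2 / α) * (Δt * ∑ n ∈ Finset.Icc 1 m, ρ n ^ 2) := by
    simp only [Finset.mul_sum]
    exact add_sum_Icc_le_of_step (x := fun n => ‖e n‖ ^ 2) fun n hn =>
      energy_step_of_young hΔt hα (hρ _ (by lia) (by lia)) (hPoincare _ (by lia) (by lia))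
        (hstep n (by lia))
  set R := Δt * ∑ n ∈ Finset.Icc 1 N, ρ n ^ 2 with hR
  have hR0 : 0 ≤ R := by positivity
  have bound : ∀ x, x ≤ ‖e 0‖ ^ 2 + CP ^ 2 * (2 / α) * R →
      √x ≤ ‖e 0‖ + CP * √(2 / α) * √R := by
    intro x hx
    refine Real.sqrt_le_iff.mpr ⟨by positivity, hx.trans ?_⟩
    have hcross : 0 ≤ ‖e 0‖ * (CP * √(2 / α) * √R) := by positivity
    calc ‖e 0‖ ^ 2 + CP ^ 2 * (2 / α) * R
        = ‖e 0‖ ^ 2 + (CP * √(2 / α) * √R) ^ 2 := by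
          rw [mul_pow, mul_pow, Real.sq_sqrt hR0, Real.sq_sqrt (by positivity)]
      _ ≤ (‖e 0‖ + CP * √(2 / α) * √R) ^ 2 := by linarith
  have hmax : (Finset.Icc 1 N).sup' (Finset.nonempty_Icc.mpr hN) (fun n => ‖e n‖)
      ≤ ‖e 0‖ + CP * √(2 / α) * √R := by
    refine Finset.sup'_le _ _ fun m hm => ?_
    obtain ⟨-, hmN⟩ := Finset.mem_Icc.mp hm
    rw [← Real.sqrt_sq (norm_nonneg (e m))]
    refine bound _ ?_
    have hS : 0 ≤ α * Δt * ∑ n ∈ Finset.Icc 1 m, s n ^ 2 := by positivity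
    have hmono : ∑ n ∈ Finset.Icc 1 m, ρ n ^ 2 ≤ ∑ n ∈ Finset.Icc 1 N, ρ n ^ 2 :=
      Finset.sum_le_sum_of_subset_of_nonneg (Finset.Icc_subset_Icc_right hmN)
        fun _ _ _ => sq_nonneg _
    calc ‖e m‖ ^ 2
        ≤ ‖e 0‖ ^ 2 + CP ^ 2 * (2 / α) * (Δt * ∑ n ∈ Finset.Icc 1 m, ρ n ^ 2) := by
          linarith [energy m hmN]
      _ ≤ ‖e 0‖ ^ 2 + CP ^ 2 * (2 / α) * R := by rw [hR]; gcongr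
  have hsum := bound (α * Δt * ∑ n ∈ Finset.Icc 1 N, s n ^ 2)
    (by linarith [energy N le_rfl, sq_nonneg ‖e N‖])
  linarith
end
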